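/- arXiv:1704.02804 — 2 statements merged into one kernel-verified Lean document; each statement's English description precedes it below -/
import Mathlib

section
/- An operator T ∈ M is radial, i.e. the function Tδ_e : W → ℂ satisfies (Tδ_e)(v) = (Tδ_e)(w) whenever ℓ(v) = ℓ(w), if and only if T belongs to the double centralizer of {h}; that is, {T ∈ M : Tδ_e is radial} = C(C({h})). In particular the set of radial operators in M forms an algebra, namely the von Neumann algebra generated by h. -/
noncomputable section

open scoped ComplexInnerProductSpace

namespace UCoxMasa

/-- The universal Coxeter matrix on `Fin L`: all off-diagonal entries are `0` (representing ∞). -/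
def Mat (L : ℕ) : CoxeterMatrix (Fin L) where
  M := fun i j => if i = j then 1 else 0
  isSymm := by
    ext i j
    by_cases h : i = j <;> simp [Matrix.transpose, h, eq_comm]
  diagonal := fun i => by simp
  off_diagonal := fun i j h => by simp [h]

/-- The universal Coxeter group on `L` generators: free product of `L` copies of `ℤ/2ℤ`. -/
abbrev W (L : ℕ) : Type := (Mat L).Group

/-- The distinguished Coxeter system of `W L`. -/
def cs (L : ℕ) : CoxeterSystem (Mat L) (W L) := CoxeterMatrix.toCoxeterSystem (Mat L)

/-- The simple reflection associated to `i : Fin L`. -/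
def σ {L : ℕ} (i : Fin L) : W L := (cs L).simple i

/-- Word length on `W L` with respect to the generating set of simple reflections. -/
def len {L : ℕ} (w : W L) : ℕ := (cs L).length w

/-- The Hilbert space `ℓ²(W)`. -/
abbrev H (L : ℕ) : Type := lp (fun _ : W L => ℂ) 2

/-- The standard orthonormal basis vector `δ_w` of `ℓ²(W)`. -/
def δ {L : ℕ} (w : W L) : H L :=
  letI := Classical.decEq (W L)
  lp.single 2 w 1

/-- `V l`: the linear span of `{δ_w : ℓ(w) = l}`. -/
def V (L : ℕ) (l : ℕ) : Submodule ℂ (H L) :=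
  Submodule.span ℂ {x : H L | ∃ w : W L, len w = l ∧ x = δ w}

/-- `S_l`: the linear span of `q_l(h V_{l-1}) ∪ q_l(R_h V_{l-1})`,
given the projections `Q`, the operator `h` and the right operator `Rh`. -/
def Sl (L : ℕ) (Q : ℕ → (H L →L[ℂ] H L)) (h Rh : H L →L[ℂ] H L) (l : ℕ) :
    Submodule ℂ (H L) :=
  Submodule.span ℂ
    ({x : H L | ∃ y ∈ V L (l - 1), x = Q l (h y)} ∪
      {x : H L | ∃ y ∈ V L (l - 1), x = Q l (Rh y)})

end UCoxMasa


namespace UCoxMasa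

section Combinatorics

variable {L : ℕ}

/-- Reduced words of the universal Coxeter group: lists without equal neighbours. -/
abbrev RedWord (L : ℕ) : Type := {l : List (Fin L) // l.IsChain (· ≠ ·)}

/-- Left multiplication of a reduced word by a letter. -/
def letterMul (s : Fin L) (l : RedWord L) : RedWord L :=
  if hl : l.1.head? = some s then ⟨l.1.tail, l.2.tail⟩
  else ⟨s :: l.1, List.isChain_cons.2 ⟨fun y hy hsy => hl (by rw [hsy]; exact hy), l.2⟩⟩

lemma letterMul_of_head {s : Fin L} {l : RedWord L} (hl : l.1.head? = some s) :
    (letterMul s l).1 = l.1.tail := by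
  simp [letterMul, hl]

lemma letterMul_of_not_head {s : Fin L} {l : RedWord L} (hl : l.1.head? ≠ some s) :
    (letterMul s l).1 = s :: l.1 := by
  simp [letterMul, hl]

lemma letterMul_letterMul (s : Fin L) (l : RedWord L) : letterMul s (letterMul s l) = l := by
  apply Subtype.ext
  by_cases hl : l.1.head? = some s
  · obtain ⟨l, hc⟩ := l
    cases l with
    | nil => simp at hl
    | cons a l =>
      obtain rfl : a = s := by simpa using hl
      have h1 := letterMul_of_head (l := ⟨a :: l, hc⟩) hl
      rw [letterMul_of_not_head, h1]
      · rfl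
      · rw [h1]
        intro h2
        exact (List.isChain_cons.1 hc).1 a h2 rfl
  · have h1 := letterMul_of_not_head hl
    rw [letterMul_of_head, h1]
    · rfl
    · rw [h1]; rfl

/-- `letterMul` with values in the monoid of self-maps of the set of reduced words. -/
def letterEnd (s : Fin L) : Function.End (RedWord L) := letterMul s

lemma isLiftable_letterEnd : CoxeterMatrix.IsLiftable (Mat L) letterEnd := by
  intro i j
  by_cases hij : i = j
  · subst hij
    have : (Mat L).M i i = 1 := (Mat L).diagonal i
    rw [this, pow_one]
    funext l
    exact letterMul_letterMul i l
  · have : (Mat L).M i j = 0 := by simp [Mat, hij]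
    rw [this, pow_zero]

/-- The reduced word representing a group element. -/
def nf (w : W L) : RedWord L :=
  (cs L).lift ⟨_, isLiftable_letterEnd⟩ w ⟨[], List.isChain_nil⟩

lemma nf_one : (nf (1 : W L)).1 = [] := by
  unfold nf; rw [map_one]; rfl

lemma nf_simple_mul (s : Fin L) (w : W L) : nf (σ s * w) = letterMul s (nf w) := by
  unfold nf σ
  rw [map_mul, CoxeterSystem.lift_apply_simple]
  rfl

lemma σ_mul_cancel_left (s : Fin L) (w : W L) : σ s * (σ s * w) = w :=
  (cs L).simple_mul_simple_cancel_left s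

lemma σ_mul_cancel_right (s : Fin L) (w : W L) : w * σ s * σ s = w :=
  (cs L).simple_mul_simple_cancel_right s

lemma σ_inv (s : Fin L) : (σ s)⁻¹ = σ s := (cs L).inv_simple s

lemma wordProd_letterMul (s : Fin L) (l : RedWord L) :
    (cs L).wordProd (letterMul s l).1 = σ s * (cs L).wordProd l.1 := by
  by_cases hl : l.1.head? = some s
  · rw [letterMul_of_head hl]
    obtain ⟨l, hc⟩ := l
    cases l with
    | nil => simp at hl
    | cons a l =>
      obtain rfl : a = s := by simpa using hl
      rw [CoxeterSystem.wordProd_cons]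
      exact (σ_mul_cancel_left a _).symm
  · rw [letterMul_of_not_head hl, CoxeterSystem.wordProd_cons]; rfl

lemma wordProd_nf (w : W L) : (cs L).wordProd (nf w).1 = w := by
  induction w using (cs L).simple_induction_left with
  | one => rw [nf_one]; exact (cs L).wordProd_nil
  | mul_simple_left w i ih =>
    have := wordProd_letterMul i (nf w)
    rw [ih, ← nf_simple_mul] at this
    exact this

lemma nf_wordProd (l : List (Fin L)) (hl : l.IsChain (· ≠ ·)) :
    (nf ((cs L).wordProd l)).1 = l := by
  induction l with
  | nil => rw [CoxeterSystem.wordProd_nil]; exact nf_one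
  | cons a l ih =>
    have h1 := List.isChain_cons.1 hl
    have h2 := ih h1.2
    have h3 : (cs L).wordProd (a :: l) = σ a * (cs L).wordProd l := (cs L).wordProd_cons a l
    rw [h3, nf_simple_mul, letterMul_of_not_head, h2]
    rw [h2]
    exact fun h4 => h1.1 a h4 rfl

lemma length_letterMul_le (s : Fin L) (l : RedWord L) :
    (letterMul s l).1.length ≤ l.1.length + 1 := by
  by_cases hl : l.1.head? = some s
  · rw [letterMul_of_head hl, List.length_tail]; omega
  · rw [letterMul_of_not_head hl, List.length_cons]

lemma len_eq_length_nf (w : W L) : len w = (nf w).1.length := by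
  apply le_antisymm
  · conv_lhs => rw [← wordProd_nf w]
    exact (cs L).length_wordProd_le _
  · obtain ⟨l, hl, hw⟩ := (cs L).exists_isReduced w
    have key : ∀ l : List (Fin L), (nf ((cs L).wordProd l)).1.length ≤ l.length := by
      intro l
      induction l with
      | nil => rw [CoxeterSystem.wordProd_nil, nf_one]
      | cons a l ih =>
        have h3 : (cs L).wordProd (a :: l) = σ a * (cs L).wordProd l := (cs L).wordProd_cons a l
        rw [h3, nf_simple_mul, List.length_cons]
        exact (length_letterMul_le a _).trans (by omega)
    have h1 : len w = l.length := by rw [hw]; exact hl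
    rw [h1, hw]
    exact key l

/-- `s` is a left descent of `w`. -/
abbrev Desc (s : Fin L) (w : W L) : Prop := len (σ s * w) < len w

lemma desc_iff (s : Fin L) (w : W L) : Desc s w ↔ (nf w).1.head? = some s := by
  unfold Desc
  rw [len_eq_length_nf, len_eq_length_nf, nf_simple_mul]
  by_cases hl : (nf w).1.head? = some s
  · rw [letterMul_of_head hl]
    simp only [hl, iff_true]
    rcases h : (nf w).1 with _ | ⟨a, l⟩
    · simp [h] at hl
    · simp
  · rw [letterMul_of_not_head hl]
    simp [hl]

lemma len_one : len (1 : W L) = 0 := (cs L).length_one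

lemma len_inv (w : W L) : len w⁻¹ = len w := (cs L).length_inv w

lemma len_eq_zero {w : W L} : len w = 0 ↔ w = 1 := (cs L).length_eq_zero_iff

lemma len_of_desc {s : Fin L} {w : W L} (hs : Desc s w) : len (σ s * w) + 1 = len w :=
  (cs L).isLeftDescent_iff.1 hs

lemma len_of_not_desc {s : Fin L} {w : W L} (hs : ¬ Desc s w) : len (σ s * w) = len w + 1 :=
  (cs L).not_isLeftDescent_iff.1 hs

lemma not_desc_one (s : Fin L) : ¬ Desc s (1 : W L) := (cs L).not_isLeftDescent_one s

lemma desc_simple_mul_iff (s : Fin L) (w : W L) : Desc s (σ s * w) ↔ ¬ Desc s w := by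
  have h := (cs L).length_simple_mul_ne w s
  change len (σ s * w) ≠ len w at h
  simp only [Desc, σ_mul_cancel_left]
  omega

lemma existsUnique_desc {w : W L} (hw : w ≠ 1) : ∃ s, ∀ t, Desc t w ↔ t = s := by
  obtain ⟨s, hs⟩ := (cs L).exists_leftDescent_of_ne_one hw
  change Desc s w at hs
  refine ⟨s, fun t => ⟨fun ht => ?_, fun ht => ht ▸ hs⟩⟩
  rw [desc_iff] at hs ht
  simpa [hs, eq_comm] using ht

lemma desc_mul_simple_iff {s t : Fin L} {w : W L} (hst : σ s * w ≠ w * σ t) :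
    Desc s (w * σ t) ↔ Desc s w := by
  rw [desc_iff, desc_iff]
  have hw := wordProd_nf w
  have hc := (nf w).2
  generalize (nf w).1 = l at hw hc
  by_cases hl : l.getLast? = some t
  · obtain ⟨l', rfl⟩ := List.getLast?_eq_some_iff.1 hl
    have h1 : w * σ t = (cs L).wordProd l' := by
      rw [← hw, CoxeterSystem.wordProd_append, CoxeterSystem.wordProd_singleton]
      exact σ_mul_cancel_right t _
    have h2 : l'.IsChain (· ≠ ·) := (List.isChain_append.1 hc).1
    rw [h1, nf_wordProd _ h2]
    cases l' with
    | nil =>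
      have h3 : s ≠ t := by
        rintro rfl
        apply hst
        rw [h1, ← hw]
        simp [σ]
      simpa using h3.symm
    | cons a l' => simp
  · have h1 : w * σ t = (cs L).wordProd (l ++ [t]) := by
      rw [← hw, CoxeterSystem.wordProd_append, CoxeterSystem.wordProd_singleton]; rfl
    have h2 : (l ++ [t]).IsChain (· ≠ ·) := by
      refine List.isChain_append.2 ⟨hc, List.isChain_singleton t, ?_⟩
      rintro x hx y hy rfl
      simp only [List.head?_cons, Option.mem_def, Option.some.injEq] at hy
      exact hl (hy ▸ hx)
    rw [h1, nf_wordProd _ h2]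
    cases l with
    | nil =>
      have h3 : s ≠ t := by
        rintro rfl
        apply hst
        rw [← hw, CoxeterSystem.wordProd_nil, one_mul, mul_one]
      simpa using h3.symm
    | cons a l => simp

end Combinatorics

section Hilbert

open Filter Topology ContinuousLinearMap

variable {L : ℕ}

lemma inner_δ_left (w : W L) (f : H L) : inner ℂ (δ w) f = f w := by
  classical
  unfold δ
  rw [lp.inner_single_left]
  simp

lemma inner_δ_right (w : W L) (f : H L) : inner ℂ f (δ w) = star (f w) := by
  rw [← inner_conj_symm, inner_δ_left]; rfl

open Classical in
lemma δ_apply (v w : W L) : (δ v : H L) w = if w = v then 1 else 0 := by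
  unfold δ
  rw [lp.single_apply, Pi.single_apply]

lemma δ_one_apply (w : W L) : (δ 1 : H L) w = if len w = 0 then 1 else 0 := by
  rw [δ_apply]
  by_cases hw : w = 1
  · rw [if_pos hw, if_pos (len_eq_zero.2 hw)]
  · rw [if_neg hw, if_neg (mt len_eq_zero.1 hw)]

/-- The standard Hilbert basis of `ℓ²(W)`. -/
def stdBasis (L : ℕ) : HilbertBasis (W L) ℂ (H L) :=
  HilbertBasis.ofRepr (LinearIsometryEquiv.refl ℂ (H L))

lemma stdBasis_apply (w : W L) : stdBasis L w = δ w := by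
  classical
  rw [← HilbertBasis.repr_symm_single, δ]
  change lp.single (E := fun _ : W L => ℂ) 2 w (1 : ℂ) = _
  congr

lemma dense_span_δ : Dense (Submodule.span ℂ (Set.range (δ : W L → H L)) : Set (H L)) := by
  have h := (stdBasis L).dense_span
  rw [show (⇑(stdBasis L)) = δ from funext stdBasis_apply] at h
  rwa [Submodule.dense_iff_topologicalClosure_eq_top]

lemma clm_ext {A B : H L →L[ℂ] H L} (hAB : ∀ w, A (δ w) = B (δ w)) : A = B :=
  ContinuousLinearMap.ext_on dense_span_δ (by rintro _ ⟨w, rfl⟩; exact hAB w)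

lemma clm_ext_apply {A B : H L →L[ℂ] H L} (hAB : ∀ v w, (A (δ v)) w = (B (δ v)) w) : A = B :=
  clm_ext fun v => lp.ext (funext (hAB v))

lemma orthonormal_δ : Orthonormal ℂ (δ : W L → H L) := by
  have h := (stdBasis L).orthonormal
  rwa [show (⇑(stdBasis L)) = δ from funext stdBasis_apply] at h

/-- The Hilbert basis `δ_{w⁻¹}`, indexed by `w`. -/
def invBasis (L : ℕ) : HilbertBasis (W L) ℂ (H L) :=
  HilbertBasis.mk (v := fun w : W L => δ w⁻¹) (orthonormal_δ.comp _ inv_injective) (by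
    have h1 : Set.range (fun w : W L => (δ w⁻¹ : H L)) = Set.range δ :=
      (inv_surjective (G := W L)).range_comp δ
    rw [h1, Submodule.dense_iff_topologicalClosure_eq_top.1 dense_span_δ])

/-- The flip operator `δ_w ↦ δ_{w⁻¹}`. -/
def flip (L : ℕ) : H L →L[ℂ] H L :=
  ((invBasis L).repr.symm.toContinuousLinearEquiv : H L →L[ℂ] H L)

lemma flip_δ (w : W L) : flip L (δ w) = δ w⁻¹ := by
  classical
  have h := (invBasis L).repr_symm_single w
  rw [show invBasis L w = δ w⁻¹ by simp [invBasis]] at h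
  rw [← h, δ]
  change (invBasis L).repr.symm _ = _
  congr

lemma star_apply_δ (A : H L →L[ℂ] H L) (v w : W L) :
    (star A (δ v)) w = star ((A (δ w)) v) := by
  rw [← inner_δ_left, star_eq_adjoint, adjoint_inner_right, inner_δ_right]

lemma star_flip : star (flip L) = flip L := by
  classical
  refine clm_ext_apply fun v w => ?_
  rw [star_apply_δ, flip_δ, flip_δ, δ_apply, δ_apply]
  simp only [eq_comm (a := v), inv_eq_iff_eq_inv]
  split_ifs <;> simp

lemma tendsto_inner_truncation (f g : H L) (F : ℕ → H L)
    (hF : ∀ n w, F n w = if len w < n then f w else 0) :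
    Tendsto (fun n => inner ℂ (F n) g) atTop (𝓝 (inner ℂ f g)) := by
  simp only [lp.inner_eq_tsum]
  refine tendsto_tsum_of_dominated_convergence (bound := fun w => ‖inner ℂ (f w) (g w)‖)
    (lp.summable_inner (𝕜 := ℂ) f g).norm (fun w => ?_) (Eventually.of_forall fun n w => ?_)
  · refine tendsto_const_nhds.congr' ?_
    filter_upwards [eventually_gt_atTop (len w)] with n hn
    rw [hF, if_pos hn]
  · rw [hF]
    split_ifs
    · exact le_rfl
    · rw [inner_zero_left, norm_zero]
      exact norm_nonneg _

end Hilbert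

section HeckeOperators

open Filter Topology ContinuousLinearMap

variable {L : ℕ} {p : ℝ} {T : Fin L → H L →L[ℂ] H L}

open Classical in
/-- The diagonal coefficient of `T_s` at `w`. -/
def diagCoeff (p : ℝ) (s : Fin L) (w : W L) : ℂ := if Desc s w then (p : ℂ) else 0

/-- The family `T` acts on the standard basis like the generators of the Hecke algebra. -/
def IsHecke (p : ℝ) (T : Fin L → H L →L[ℂ] H L) : Prop :=
  ∀ s w, T s (δ w) = δ (σ s * w) + diagCoeff p s w • δ w

/-- The right multiplication operators, obtained by conjugating with the flip. -/
def rightOp (T : Fin L → H L →L[ℂ] H L) (t : Fin L) : H L →L[ℂ] H L := flip L * T t * flip L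

/-- The right multiplication operator along a word. -/
def rightWord (T : Fin L → H L →L[ℂ] H L) (l : List (Fin L)) : H L →L[ℂ] H L :=
  (l.map (rightOp T)).prod

lemma star_diagCoeff (s : Fin L) (w : W L) : star (diagCoeff p s w) = diagCoeff p s w := by
  unfold diagCoeff
  split_ifs
  · exact Complex.conj_ofReal p
  · exact star_zero _

lemma diagCoeff_simple_mul (s : Fin L) (w : W L) :
    diagCoeff p s (σ s * w) = p - diagCoeff p s w := by
  unfold diagCoeff
  by_cases h : Desc s w
  · rw [if_neg (fun h' => (desc_simple_mul_iff s w).1 h' h), if_pos h, sub_self]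
  · rw [if_pos ((desc_simple_mul_iff s w).2 h), if_neg h, sub_zero]

lemma diagCoeff_mul_simple {s t : Fin L} {w : W L} (hst : σ s * w ≠ w * σ t) :
    diagCoeff p s (w * σ t) = diagCoeff p s w := by
  unfold diagCoeff
  simp only [desc_mul_simple_iff hst]

lemma diagCoeff_inv {s t : Fin L} {w : W L} (hst : σ s * w = w * σ t) :
    diagCoeff p t w⁻¹ = diagCoeff p s w := by
  have h : Desc t w⁻¹ ↔ Desc s w := by
    unfold Desc
    rw [show σ t * w⁻¹ = (w * σ t)⁻¹ by rw [mul_inv_rev, σ_inv], len_inv, len_inv, hst]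
  unfold diagCoeff
  simp only [h]

lemma sum_diagCoeff (w : W L) : ∑ s, diagCoeff p s w = if len w = 0 then 0 else (p : ℂ) := by
  classical
  by_cases hw : w = 1
  · rw [if_pos (len_eq_zero.2 hw)]
    refine Finset.sum_eq_zero fun s _ => ?_
    rw [diagCoeff, if_neg]
    rw [hw]; exact not_desc_one s
  · rw [if_neg (mt len_eq_zero.1 hw)]
    obtain ⟨s, hs⟩ := existsUnique_desc hw
    simp [diagCoeff, hs]

lemma IsHecke.star_eq (hT : IsHecke p T) (s : Fin L) : star (T s) = T s := by
  refine clm_ext_apply fun v w => ?_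
  rw [star_apply_δ, hT, hT]
  simp only [lp.coeFn_add, lp.coeFn_smul, Pi.add_apply, Pi.smul_apply, δ_apply, star_add,
    star_smul, star_diagCoeff]
  congr 1
  · have : v = σ s * w ↔ w = σ s * v :=
      ⟨fun h => by rw [h, σ_mul_cancel_left], fun h => by rw [h, σ_mul_cancel_left]⟩
    by_cases h : v = σ s * w
    · rw [if_pos h, if_pos (this.1 h), star_one]
    · rw [if_neg h, if_neg (mt this.2 h), star_zero]
  · by_cases h : v = w
    · subst h; simp
    · simp [h, Ne.symm h]

lemma IsHecke.apply_apply (hT : IsHecke p T) (s : Fin L) (f : H L) (w : W L) :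
    (T s f) w = f (σ s * w) + diagCoeff p s w * f w := by
  rw [← inner_δ_left, ← adjoint_inner_left, ← star_eq_adjoint, hT.star_eq, hT, inner_add_left,
    inner_smul_left, inner_δ_left, inner_δ_left]
  congr 2
  exact star_diagCoeff s w

lemma IsHecke.rightOp_δ (hT : IsHecke p T) (t : Fin L) (w : W L) :
    rightOp T t (δ w) = δ (w * σ t) + diagCoeff p t w⁻¹ • δ w := by
  simp only [rightOp, mul_apply_eq_comp, flip_δ, hT t, map_add, map_smul, mul_inv_rev,
    inv_inv, σ_inv]

lemma IsHecke.star_rightOp (hT : IsHecke p T) (t : Fin L) : star (rightOp T t) = rightOp T t := by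
  simp only [rightOp, star_mul, star_flip, hT.star_eq, mul_assoc]

lemma IsHecke.commute_rightOp (hT : IsHecke p T) (s t : Fin L) :
    Commute (T s) (rightOp T t) := by
  refine clm_ext fun w => ?_
  simp only [mul_apply_eq_comp, hT.rightOp_δ, hT s, map_add, map_smul, smul_add,
    mul_assoc]
  have hinv : (σ s * w)⁻¹ = w⁻¹ * σ s := by rw [mul_inv_rev, σ_inv]
  rw [hinv]
  by_cases hst : σ s * w = w * σ t
  · have h1 : w⁻¹ * σ s = σ t * w⁻¹ := by
      rw [← hinv, hst, mul_inv_rev, σ_inv]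
    rw [h1, diagCoeff_simple_mul, ← hst, diagCoeff_simple_mul, diagCoeff_inv hst]
  · have h1 : σ t * w⁻¹ ≠ w⁻¹ * σ s := by
      intro h
      apply hst
      have := congrArg (·⁻¹) h
      simpa [mul_inv_rev, σ_inv, eq_comm] using this
    rw [diagCoeff_mul_simple hst, diagCoeff_mul_simple h1]
    module

lemma IsHecke.rightWord_mem (hT : IsHecke p T) (l : List (Fin L)) :
    rightWord T l ∈ (Set.range T).centralizer := by
  rintro _ ⟨s, rfl⟩
  induction l with
  | nil => simp [rightWord]
  | cons a l ih =>
    have h1 : Commute (T s) (rightWord T l) := ih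
    have h2 : rightWord T (a :: l) = rightOp T a * rightWord T l := by simp [rightWord]
    rw [h2]
    exact (hT.commute_rightOp s a).mul_right h1

lemma IsHecke.star_rightWord (hT : IsHecke p T) (l : List (Fin L)) :
    star (rightWord T l) = rightWord T l.reverse := by
  induction l with
  | nil => simp [rightWord]
  | cons a l ih =>
    simp only [rightWord, List.map_cons, List.prod_cons, star_mul, List.reverse_cons,
      List.map_append, List.prod_append, List.map_nil, List.prod_nil, mul_one,
      hT.star_rightOp] at ih ⊢
    rw [ih]

lemma IsHecke.rightWord_δ_one (hT : IsHecke p T) (l : List (Fin L)) (hl : l.IsChain (· ≠ ·)) :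
    rightWord T l (δ 1) = δ ((cs L).wordProd l)⁻¹ := by
  induction l with
  | nil => simp [rightWord]
  | cons a l ih =>
    have h1 := List.isChain_cons.1 hl
    have h2 : rightWord T (a :: l) = rightOp T a * rightWord T l := by simp [rightWord]
    have h3 : (cs L).wordProd (a :: l) = σ a * (cs L).wordProd l := (cs L).wordProd_cons a l
    have h4 : ¬ Desc a ((cs L).wordProd l) := by
      rw [desc_iff, nf_wordProd l h1.2]
      exact fun h => h1.1 a h rfl
    rw [h2, mul_apply_eq_comp, ih h1.2, hT.rightOp_δ, inv_inv, diagCoeff, if_neg h4,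
      zero_smul, add_zero, h3, mul_inv_rev, σ_inv]

lemma IsHecke.exists_right (hT : IsHecke p T) (w : W L) :
    ∃ r ∈ (Set.range T).centralizer, star r ∈ (Set.range T).centralizer ∧
      r (δ 1) = δ w ∧ star r (δ 1) = δ w⁻¹ := by
  have hc := (nf w).2
  have hc' : (nf w).1.reverse.IsChain (· ≠ ·) := by
    rw [List.isChain_reverse]
    simpa only [ne_comm] using hc
  refine ⟨rightWord T (nf w).1.reverse, hT.rightWord_mem _, ?_, ?_, ?_⟩
  · rw [hT.star_rightWord]; exact hT.rightWord_mem _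
  · rw [hT.rightWord_δ_one _ hc', CoxeterSystem.wordProd_reverse, wordProd_nf, inv_inv]
  · rw [hT.star_rightWord, List.reverse_reverse, hT.rightWord_δ_one _ hc, wordProd_nf]

lemma IsHecke.sum_apply (hT : IsHecke p T) (f : H L) (w : W L) :
    ((∑ s, T s) f) w = ∑ s, f (σ s * w) + (if len w = 0 then 0 else (p : ℂ)) * f w := by
  rw [← sum_diagCoeff, Finset.sum_mul, ← Finset.sum_add_distrib, _root_.sum_apply,
    lp.coeFn_sum, Finset.sum_apply]
  exact Finset.sum_congr rfl fun s _ => hT.apply_apply s f w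

lemma IsHecke.star_sum (hT : IsHecke p T) : star (∑ s, T s) = ∑ s, T s := by
  rw [_root_.star_sum]
  exact Finset.sum_congr rfl fun s _ => hT.star_eq s

/-- The action of `∑ s, T s` on radial functions. -/
def radialAction (L : ℕ) (p : ℝ) (φ : ℕ → ℂ) : ℕ → ℂ
  | 0 => L * φ 1
  | n + 1 => φ n + (L - 1) * φ (n + 2) + p * φ (n + 1)

lemma IsHecke.sum_apply_radial (hT : IsHecke p T) {f : H L} {φ : ℕ → ℂ}
    (hf : ∀ w, f w = φ (len w)) (w : W L) :
    ((∑ s, T s) f) w = radialAction L p φ (len w) := by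
  classical
  rw [hT.sum_apply]
  simp only [hf]
  by_cases hw : w = 1
  · have h1 : ∀ s : Fin L, len (σ s * w) = 1 := fun s => by
      rw [len_of_not_desc (by rw [hw]; exact not_desc_one s), hw, len_one]
    have h0 : len w = 0 := len_eq_zero.2 hw
    simp [h1, h0, radialAction]
  · have h0 : len w ≠ 0 := mt len_eq_zero.1 hw
    obtain ⟨n, hn⟩ := Nat.exists_eq_succ_of_ne_zero h0
    obtain ⟨s, hs⟩ := existsUnique_desc hw
    have h1 : len (σ s * w) = n := by
      have := len_of_desc ((hs s).2 rfl)
      omega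
    have h2 : ∀ t ∈ Finset.univ.erase s, φ (len (σ t * w)) = φ (n + 2) := fun t ht => by
      rw [len_of_not_desc (fun h => (Finset.mem_erase.1 ht).1 ((hs t).1 h)), hn]
    have h3 : 1 ≤ L := s.pos
    rw [← Finset.add_sum_erase _ _ (Finset.mem_univ s), Finset.sum_congr rfl h2, h1, if_neg h0, hn,
      Finset.sum_const, Finset.card_erase_of_mem (Finset.mem_univ s), Finset.card_univ,
      Fintype.card_fin, nsmul_eq_mul, Nat.cast_sub h3, Nat.cast_one]
    rfl

/-- The sphere operators `h_n` as polynomials in `h`. -/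
def sphereOp (p : ℝ) (h : H L →L[ℂ] H L) : ℕ → (H L →L[ℂ] H L)
  | 0 => 1
  | 1 => h
  | n + 2 => h * sphereOp p h (n + 1) - (p : ℂ) • sphereOp p h (n + 1)
      - (if n = 0 then (L : ℂ) else (L : ℂ) - 1) • sphereOp p h n

lemma commute_sphereOp {h y : H L →L[ℂ] H L} (hy : Commute y h) (n : ℕ) :
    Commute y (sphereOp p h n) := by
  induction n using sphereOp.induct with
  | case1 => exact Commute.one_right y
  | case2 => exact hy
  | case3 n ih1 ih2 =>
    rw [sphereOp]
    exact ((hy.mul_right ih1).sub_right (ih1.smul_right _)).sub_right (ih2.smul_right _)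

lemma star_sphereOp {h : H L →L[ℂ] H L} (hh : star h = h) (n : ℕ) :
    star (sphereOp p h n) = sphereOp p h n := by
  induction n using sphereOp.induct with
  | case1 => exact star_one _
  | case2 => exact hh
  | case3 n ih1 ih2 =>
    have hc : Commute h (sphereOp p h (n + 1)) := commute_sphereOp (Commute.refl h) _
    have hr : star (if n = 0 then (L : ℂ) else (L : ℂ) - 1)
        = if n = 0 then (L : ℂ) else (L : ℂ) - 1 := by
      split_ifs <;> simp
    rw [sphereOp, star_sub, star_sub, star_mul, star_smul, star_smul, ih1, ih2, hh, hr, hc.eq]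
    congr 3
    exact Complex.conj_ofReal p

lemma IsHecke.sphereOp_δ_one (hT : IsHecke p T) (n : ℕ) (w : W L) :
    (sphereOp p (∑ s, T s) n (δ 1)) w = if len w = n then 1 else 0 := by
  induction n using sphereOp.induct generalizing w with
  | case1 =>
    rw [sphereOp, one_apply_eq_self, δ_one_apply]
  | case2 =>
    rw [sphereOp, hT.sum_apply_radial (φ := fun k => if k = 0 then 1 else 0)
      δ_one_apply]
    rcases len w with _ | k <;> simp [radialAction]
  | case3 n ih1 ih2 =>
    have h1 := hT.sum_apply_radial (φ := fun k => if k = n + 1 then 1 else 0) ih1 w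
    rw [sphereOp]
    simp only [sub_apply, mul_apply_eq_comp,
      smul_apply, lp.coeFn_sub, lp.coeFn_smul, Pi.sub_apply, Pi.smul_apply,
      ih1, ih2, h1]
    rcases len w with _ | k
    · by_cases hn : n = 0
      · simp [radialAction, hn]
      · simp [radialAction, hn, Ne.symm hn]
    · by_cases hn : n = 0
      · subst hn
        by_cases hk0 : k = 0 <;> by_cases hk1 : k = 1 <;> simp_all [radialAction]
      · by_cases hk0 : k = n + 1
        · subst hk0
          simp only [radialAction, if_true]
          simp
          intro h
          omega
        · by_cases hk1 : k = n
          · subst hk1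
            simp [radialAction]
          · by_cases hk2 : k + 1 = n
            · subst hk2
              simp [radialAction]
              omega
            · simp [radialAction, hn, hk0, hk1, hk2]

end HeckeOperators

section DoubleCentralizer

open Filter Topology ContinuousLinearMap

variable {L : ℕ} {p : ℝ} {T : Fin L → H L →L[ℂ] H L}

/-- The closed subspace of radial vectors. -/
def radialSubmodule (L : ℕ) : Submodule ℂ (H L) where
  carrier := {f | ∀ v w : W L, len v = len w → f v = f w}
  add_mem' {f g} hf hg v w hvw := by
    rw [lp.coeFn_add, Pi.add_apply, Pi.add_apply, hf v w hvw, hg v w hvw]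
  zero_mem' _ _ _ := rfl
  smul_mem' c f hf v w hvw := by
    rw [lp.coeFn_smul, Pi.smul_apply, Pi.smul_apply, hf v w hvw]

lemma isClosed_radialSubmodule : IsClosed (radialSubmodule L : Set (H L)) := by
  have h : (radialSubmodule L : Set (H L)) =
      ⋂ (v : W L) (w : W L) (_ : len v = len w), {f : H L | inner ℂ (δ v) f = inner ℂ (δ w) f} := by
    ext f
    simp only [Set.mem_iInter, Set.mem_ofPred_eq, inner_δ_left]
    rfl
  rw [h]
  exact isClosed_iInter fun v => isClosed_iInter fun w => isClosed_iInter fun _ =>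
    isClosed_eq (by fun_prop) (by fun_prop)

instance : (radialSubmodule L).HasOrthogonalProjection :=
  haveI : CompleteSpace (radialSubmodule L) := isClosed_radialSubmodule.completeSpace_coe
  inferInstance

lemma exists_radial_profile {f : H L} (hf : f ∈ radialSubmodule L) :
    ∃ φ : ℕ → ℂ, ∀ w, f w = φ (len w) := by
  have h : Function.FactorsThrough (fun w => f w) (len : W L → ℕ) := fun v w hvw => hf v w hvw
  obtain ⟨φ, hφ⟩ := (Function.factorsThrough_iff _).1 h
  exact ⟨φ, fun w => congrFun hφ w⟩

lemma commute_starProjection_of_star_eq {E : Type*} [NormedAddCommGroup E] [InnerProductSpace ℂ E]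
    [CompleteSpace E] {K : Submodule ℂ E} [K.HasOrthogonalProjection] {h : E →L[ℂ] E}
    (hs : star h = h) (hK : ∀ f ∈ K, h f ∈ K) : Commute h K.starProjection := by
  ext f
  rw [mul_apply_eq_comp, mul_apply_eq_comp]
  refine Submodule.eq_starProjection_of_mem_orthogonal (hK _ (K.starProjection_apply_mem f)) ?_
    |>.symm
  rw [← map_sub, Submodule.mem_orthogonal]
  intro u hu
  rw [← adjoint_inner_left, ← star_eq_adjoint, hs]
  exact K.inner_right_of_mem_orthogonal (hK u hu) (K.sub_starProjection_mem_orthogonal f)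

lemma IsHecke.sum_mem_radialSubmodule (hT : IsHecke p T) {f : H L} (hf : f ∈ radialSubmodule L) :
    (∑ s, T s) f ∈ radialSubmodule L := by
  obtain ⟨φ, hφ⟩ := exists_radial_profile hf
  intro v w hvw
  rw [hT.sum_apply_radial hφ, hT.sum_apply_radial hφ, hvw]

lemma δ_one_mem_radialSubmodule : (δ 1 : H L) ∈ radialSubmodule L := by
  intro v w hvw
  rw [δ_one_apply, δ_one_apply, hvw]

lemma IsHecke.radial_of_mem (hT : IsHecke p T) {x : H L →L[ℂ] H L}
    (hx : x ∈ ({∑ s, T s} : Set (H L →L[ℂ] H L)).centralizer.centralizer) :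
    x (δ 1) ∈ radialSubmodule L := by
  have hP : Commute (∑ s, T s) (radialSubmodule L).starProjection :=
    commute_starProjection_of_star_eq hT.star_sum fun f hf => hT.sum_mem_radialSubmodule hf
  have h1 := hx _ (show (radialSubmodule L).starProjection ∈ _ from
    Set.mem_centralizer_iff.2 (by rintro _ rfl; exact hP))
  have h2 := DFunLike.congr_fun h1 (δ 1)
  rw [mul_apply_eq_comp, mul_apply_eq_comp,
    Submodule.starProjection_eq_self_iff.2 δ_one_mem_radialSubmodule] at h2
  exact h2 ▸ Submodule.starProjection_apply_mem _ _

lemma IsHecke.star_apply_δ_one (hT : IsHecke p T) {x : H L →L[ℂ] H L}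
    (hx : x ∈ (Set.range T).centralizer.centralizer) (w : W L) :
    (star x (δ 1)) w = star ((x (δ 1)) w⁻¹) := by
  obtain ⟨r, hr, -, h1, h2⟩ := hT.exists_right w
  have hxr := DFunLike.congr_fun (hx r hr) (δ 1)
  rw [mul_apply_eq_comp, mul_apply_eq_comp, h1] at hxr
  rw [star_apply_δ, ← hxr, ← inner_δ_left, ← adjoint_inner_left, ← star_eq_adjoint, h2,
    inner_δ_left]

/-- The partial sums of `∑ φ(n) h_n`. -/
def partialSum (p : ℝ) (h : H L →L[ℂ] H L) (φ : ℕ → ℂ) (N : ℕ) : H L →L[ℂ] H L :=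
  ∑ n ∈ Finset.range N, φ n • sphereOp p h n

lemma commute_partialSum {h y : H L →L[ℂ] H L} (hy : Commute y h) (φ : ℕ → ℂ) (N : ℕ) :
    Commute y (partialSum p h φ N) :=
  Commute.sum_right _ _ _ fun n _ => (commute_sphereOp hy n).smul_right _

lemma star_partialSum {h : H L →L[ℂ] H L} (hh : star h = h) (φ : ℕ → ℂ) (N : ℕ) :
    star (partialSum p h φ N) = partialSum p h (fun n => star (φ n)) N := by
  simp only [partialSum, _root_.star_sum, star_smul, star_sphereOp hh]

lemma IsHecke.partialSum_δ_one (hT : IsHecke p T) (φ : ℕ → ℂ) (N : ℕ) (w : W L) :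
    (partialSum p (∑ s, T s) φ N (δ 1)) w = if len w < N then φ (len w) else 0 := by
  simp only [partialSum, _root_.sum_apply, lp.coeFn_sum, Finset.sum_apply, smul_apply,
    lp.coeFn_smul, Pi.smul_apply, hT.sphereOp_δ_one, smul_eq_mul, mul_ite, mul_one, mul_zero,
    Finset.sum_ite_eq, Finset.mem_range]

lemma IsHecke.tendsto_partialSum (hT : IsHecke p T) {f : H L} {φ : ℕ → ℂ}
    (hf : ∀ w, f w = φ (len w)) (g : H L) :
    Tendsto (fun N => inner ℂ (partialSum p (∑ s, T s) φ N (δ 1)) g) atTop (𝓝 (inner ℂ f g)) :=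
  tendsto_inner_truncation f g _ fun N w => by rw [hT.partialSum_δ_one, hf]

lemma sum_mem_doubleCentralizer (T : Fin L → H L →L[ℂ] H L) :
    ∑ s, T s ∈ (Set.range T).centralizer.centralizer := fun _ hy =>
  Commute.sum_right _ _ _ fun s _ => (hy _ ⟨s, rfl⟩).symm

lemma IsHecke.mem_of_radial (hT : IsHecke p T) {x : H L →L[ℂ] H L}
    (hx : x ∈ (Set.range T).centralizer.centralizer) (hr : x (δ 1) ∈ radialSubmodule L) :
    x ∈ ({∑ s, T s} : Set (H L →L[ℂ] H L)).centralizer.centralizer := by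
  intro y hy
  have hy' : Commute y (∑ s, T s) := (hy _ rfl).symm
  obtain ⟨φ, hφ⟩ := exists_radial_profile hr
  have hφ' : ∀ w, (star x (δ 1)) w = star (φ (len w)) := fun w => by
    rw [hT.star_apply_δ_one hx, hφ, len_inv]
  have hcomm : ∀ r ∈ (Set.range T).centralizer, ∀ (z : H L →L[ℂ] H L),
      z ∈ (Set.range T).centralizer.centralizer → ∀ f, z (r f) = r (z f) := fun r hr z hz f => by
    have := DFunLike.congr_fun (hz r hr) f
    rw [mul_apply_eq_comp, mul_apply_eq_comp] at this
    exact this.symm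
  have hcommN : ∀ r ∈ (Set.range T).centralizer, ∀ (ψ : ℕ → ℂ) N f,
      partialSum p (∑ s, T s) ψ N (r f) = r (partialSum p (∑ s, T s) ψ N f) := fun r hr ψ N =>
    hcomm r hr _ fun z hz => commute_partialSum (sum_mem_doubleCentralizer T z hz) ψ N
  have hcommy : ∀ ψ N f,
      y (partialSum p (∑ s, T s) ψ N f) = partialSum p (∑ s, T s) ψ N (y f) := fun ψ N f =>
    DFunLike.congr_fun (commute_partialSum (p := p) hy' ψ N).eq f
  refine clm_ext fun v => lp.ext (funext fun w => star_injective ?_)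
  rw [← inner_δ_right, ← inner_δ_right]
  obtain ⟨r, hr1, -, hr2, -⟩ := hT.exists_right v
  obtain ⟨r', hr1', hr3', hr2', -⟩ := hT.exists_right w
  have hl1 := hT.tendsto_partialSum hφ (star (y * r) (δ w))
  have hl2 := hT.tendsto_partialSum (φ := fun n => star (φ n)) hφ' (star r' (y (δ v)))
  have hstar : star x (r' (δ 1)) = r' (star x (δ 1)) := by
    have h3 := congrArg star (hx _ hr3')
    rw [star_mul, star_mul, star_star] at h3
    exact DFunLike.congr_fun h3 (δ 1)
  have e1 : inner ℂ (x (δ 1)) (star (y * r) (δ w)) = inner ℂ ((y * x) (δ v)) (δ w) := by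
    rw [star_eq_adjoint, adjoint_inner_right, mul_apply_eq_comp, mul_apply_eq_comp, ← hr2,
      hcomm r hr1 x hx]
  have e2 : inner ℂ (star x (δ 1)) (star r' (y (δ v))) = inner ℂ (δ w) ((x * y) (δ v)) := by
    rw [star_eq_adjoint r', adjoint_inner_right, ← hstar, hr2', star_eq_adjoint,
      adjoint_inner_left, mul_apply_eq_comp]
  rw [e1] at hl1
  rw [e2] at hl2
  have e3 : ∀ N, inner ℂ (partialSum p (∑ s, T s) φ N (δ 1)) (star (y * r) (δ w)) =
      star (inner ℂ (partialSum p (∑ s, T s) (fun n => star (φ n)) N (δ 1)) (star r' (y (δ v)))) :=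
    fun N => by
      rw [star_eq_adjoint, adjoint_inner_right, mul_apply_eq_comp, ← hcommN r hr1, hr2, hcommy,
        star_eq_adjoint r', adjoint_inner_right, ← hcommN r' hr1', hr2',
        ← star_partialSum hT.star_sum, star_eq_adjoint, adjoint_inner_left]
      exact (inner_conj_symm _ _).symm
  simp only [e3] at hl1
  have h4 := tendsto_nhds_unique hl1 hl2.star
  rw [h4]
  exact inner_conj_symm _ _

lemma IsHecke.radial_iff (hT : IsHecke p T) (x : H L →L[ℂ] H L) :
    (x ∈ (Set.range T).centralizer.centralizer ∧ x (δ 1) ∈ radialSubmodule L) ↔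
      x ∈ ({∑ s, T s} : Set (H L →L[ℂ] H L)).centralizer.centralizer := by
  refine ⟨fun hx => hT.mem_of_radial hx.1 hx.2,
    fun hx => ⟨fun y hy => hx y ?_, hT.radial_of_mem hx⟩⟩
  rintro _ rfl
  exact (sum_mem_doubleCentralizer T y hy).symm

end DoubleCentralizer

theorem statement1
    (L : ℕ) (hL : 3 ≤ L) (q p : ℝ) (hq : 0 < q) (hq1 : q ≤ 1)
    (hp : p = (q - 1) / Real.sqrt q)
    (T : Fin L → H L →L[ℂ] H L)
    (hT : ∀ (s : Fin L) (w : W L),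
      T s (δ w) =
        if len (σ s * w) < len w then δ (σ s * w) + (p : ℂ) • δ w else δ (σ s * w))
    (h : H L →L[ℂ] H L) (hh : h = ∑ s, T s)
    (R : Set (H L →L[ℂ] H L))
    (hR : R = {x : H L →L[ℂ] H L |
      x ∈ (Set.range T).centralizer.centralizer ∧
        ∀ v w : W L, len v = len w → (x (δ 1)) v = (x (δ 1)) w}) :
    R = ({h} : Set (H L →L[ℂ] H L)).centralizer.centralizer
      ∧ ∀ a ∈ R, ∀ b ∈ R, a * b ∈ R := by
  have hT' : IsHecke p T := fun s w => by
    rw [hT, diagCoeff]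
    split_ifs
    · rfl
    · rw [zero_smul, add_zero]
  have hR' : R = ({h} : Set (H L →L[ℂ] H L)).centralizer.centralizer := by
    rw [hR, hh]
    exact Set.ext fun x => hT'.radial_iff x
  refine ⟨hR', fun a ha b hb => ?_⟩
  rw [hR'] at ha hb ⊢
  exact Set.mul_mem_centralizer ha hb

end UCoxMasa
end
end

section
/- For every v, w ∈ W with ℓ(v) = ℓ(w) and every ε > 0 there exists a vector η ∈ ℓ²(W) such that ‖δ_v − δ_w − (h η − R_h η)‖ < ε, where ‖·‖ denotes the ℓ²(W) norm. -/
noncomputable section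

open scoped ComplexInnerProductSpace

namespace UCoxMasa

section Words

variable {α : Type*}

/-- A word is reduced if no two consecutive letters agree. -/
abbrev Reduced (w : List α) : Prop := w.IsChain (· ≠ ·)

/-- `F` vanishes off the reduced words. -/
def ReducedSupport (F : List α → ℂ) : Prop := ∀ w, ¬ Reduced w → F w = 0

open Classical in
/-- The indicator function of the reduced words. -/
def reducedIndicator (w : List α) : ℂ := if Reduced w then 1 else 0

open Classical in
/-- `F` precomposed with deletion of the first letter of a reduced nonempty word. -/
def tailLift (F : List α → ℂ) : List α → ℂ
  | [] => 0
  | s :: u => if Reduced (s :: u) then F u else 0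

/-- `F` precomposed with deletion of the last letter of a reduced nonempty word. -/
def initLift (F : List α → ℂ) (w : List α) : ℂ :=
  tailLift (fun u => F u.reverse) w.reverse

lemma reduced_reverse {w : List α} : Reduced w.reverse ↔ Reduced w := by
  rw [Reduced, List.isChain_reverse]
  exact ⟨fun h => h.imp fun _ _ => Ne.symm, fun h => h.imp fun _ _ => Ne.symm⟩

lemma reduced_append_singleton {w : List α} {t : α} :
    Reduced (w ++ [t]) ↔ Reduced w ∧ ∀ x ∈ w.getLast?, x ≠ t := by
  simp [Reduced, List.isChain_append]

lemma exists_ofFn_eq {l : ℕ} {w : List α} (h : w.length = l) :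
    ∃ v : Fin l → α, List.ofFn v = w := by
  subst h
  exact ⟨w.get, List.ofFn_get w⟩

variable [Fintype α]

/-- The sum of `f` over all words of length `l`. -/
def levelSum {M : Type*} [AddCommMonoid M] (l : ℕ) (f : List α → M) : M :=
  ∑ v : Fin l → α, f (List.ofFn v)

lemma levelSum_cons {M : Type*} [AddCommMonoid M] (l : ℕ) (f : List α → M) :
    levelSum (l + 1) f = levelSum l fun w => ∑ s, f (s :: w) := by
  unfold levelSum
  rw [← (Fin.consEquiv fun _ => α).sum_comp, Fintype.sum_prod_type, Finset.sum_comm]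
  simp [Fin.consEquiv, List.ofFn_succ]

lemma levelSum_snoc {M : Type*} [AddCommMonoid M] (l : ℕ) (f : List α → M) :
    levelSum (l + 1) f = levelSum l fun w => ∑ s, f (w ++ [s]) := by
  unfold levelSum
  rw [← (Fin.snocEquiv fun _ => α).sum_comp, Fintype.sum_prod_type, Finset.sum_comm]
  refine Finset.sum_congr rfl fun v _ => Finset.sum_congr rfl fun s _ => ?_
  rw [List.ofFn_succ_last]
  simp [Fin.snocEquiv]

lemma levelSum_congr {M : Type*} [AddCommMonoid M] {l : ℕ} {f g : List α → M}
    (h : ∀ w, w.length = l → f w = g w) : levelSum l f = levelSum l g :=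
  Finset.sum_congr rfl fun v _ => h _ (by simp)

/-- Sum over the letters prepended to a word. -/
def consSum : Module.End ℂ (List α → ℂ) where
  toFun F w := ∑ s, F (s :: w)
  map_add' F G := by ext; simp [Finset.sum_add_distrib]
  map_smul' c F := by ext; simp [Finset.mul_sum]

/-- Sum over the letters appended to a word. -/
def snocSum : Module.End ℂ (List α → ℂ) where
  toFun F w := ∑ s, F (w ++ [s])
  map_add' F G := by ext; simp [Finset.sum_add_distrib]
  map_smul' c F := by ext; simp [Finset.mul_sum]

lemma consSum_apply (F : List α → ℂ) (w : List α) : consSum F w = ∑ s, F (s :: w) := rfl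

lemma snocSum_apply (F : List α → ℂ) (w : List α) : snocSum F w = ∑ s, F (w ++ [s]) := rfl

lemma commute_consSum_snocSum :
    Commute (consSum : Module.End ℂ (List α → ℂ)) snocSum := by
  ext F w
  simp only [Module.End.mul_apply, consSum_apply, snocSum_apply, List.cons_append]
  exact Finset.sum_comm

/-- The function `w ↦ ∑ F (x ++ w ++ y)`, summed over words with `|x| = a` and `|y| = b`. -/
def extSum (a b : ℕ) (F : List α → ℂ) : List α → ℂ :=
  (consSum ^ a * snocSum ^ b : Module.End ℂ (List α → ℂ)) F

lemma extSum_zero_zero (F : List α → ℂ) : extSum 0 0 F = F := by simp [extSum]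

lemma consSum_extSum (a b : ℕ) (F : List α → ℂ) :
    consSum (extSum a b F) = extSum (a + 1) b F := by
  simp only [extSum, ← Module.End.mul_apply, ← mul_assoc, pow_succ']

lemma snocSum_extSum (a b : ℕ) (F : List α → ℂ) :
    snocSum (extSum a b F) = extSum a (b + 1) F := by
  simp only [extSum, ← Module.End.mul_apply, ← mul_assoc, pow_succ']
  rw [(commute_consSum_snocSum.pow_left a).eq]

lemma extSum_consSum (a b : ℕ) (F : List α → ℂ) :
    extSum a b (consSum F) = extSum (a + 1) b F := by
  simp only [extSum, ← Module.End.mul_apply, mul_assoc, pow_succ]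
  rw [(commute_consSum_snocSum.pow_right b).eq]

lemma extSum_snocSum (a b : ℕ) (F : List α → ℂ) :
    extSum a b (snocSum F) = extSum a (b + 1) F := by
  simp only [extSum, ← Module.End.mul_apply, mul_assoc, pow_succ]

lemma extSum_add (a b : ℕ) (F G : List α → ℂ) :
    extSum a b (F + G) = extSum a b F + extSum a b G := map_add _ _ _

lemma extSum_smul (a b : ℕ) (c : ℂ) (F : List α → ℂ) :
    extSum a b (c • F) = c • extSum a b F := map_smul _ _ _

lemma extSum_induction {P : (List α → ℂ) → Prop} {F : List α → ℂ} (h0 : P F)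
    (hcons : ∀ G, P G → P (consSum G)) (hsnoc : ∀ G, P G → P (snocSum G)) (a b : ℕ) :
    P (extSum a b F) := by
  induction a with
  | zero =>
    induction b with
    | zero => simpa [extSum_zero_zero]
    | succ b ih => rw [← snocSum_extSum]; exact hsnoc _ ih
  | succ a ih => rw [← consSum_extSum]; exact hcons _ ih

lemma ReducedSupport.consSum {F : List α → ℂ} (hF : ReducedSupport F) :
    ReducedSupport (consSum F) := fun _ hw =>
  Finset.sum_eq_zero fun _ _ => hF _ fun h => hw h.tail

lemma ReducedSupport.snocSum {F : List α → ℂ} (hF : ReducedSupport F) :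
    ReducedSupport (snocSum F) := fun _ hw =>
  Finset.sum_eq_zero fun _ _ => hF _ fun h => hw (reduced_append_singleton.1 h).1

lemma ReducedSupport.extSum {F : List α → ℂ} (hF : ReducedSupport F) (a b : ℕ) :
    ReducedSupport (extSum a b F) :=
  extSum_induction hF (fun _ h => h.consSum) (fun _ h => h.snocSum) a b

/-- Iterated extension sums only see words that are at least as long. -/
lemma extSum_congr {F G : List α → ℂ} {l : ℕ} (h : ∀ w, l ≤ w.length → F w = G w) (a b : ℕ) :
    ∀ w, l ≤ w.length → extSum a b F w = extSum a b G w := by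
  intro w hw
  rw [← sub_eq_zero]
  have key : ∀ w, l ≤ w.length → extSum a b (F - G) w = 0 := by
    refine extSum_induction (P := fun K => ∀ w : List α, l ≤ w.length → K w = 0) ?_ ?_ ?_ a b
    · intro w hw; simp [h w hw]
    · intro K hK w hw
      exact Finset.sum_eq_zero fun s _ => hK _ (by simp; omega)
    · intro K hK w hw
      exact Finset.sum_eq_zero fun s _ => hK _ (by simp; omega)
  have := key w hw
  rwa [extSum, map_sub] at this

lemma levelSum_consSum (l : ℕ) (F : List α → ℂ) :
    levelSum l (consSum F) = levelSum (l + 1) F := (levelSum_cons l F).symm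

lemma consSum_tailLift (F : List α → ℂ) (hF : ReducedSupport F) (w : List α) (hw : 1 ≤ w.length) :
    consSum (tailLift F) w = ((Fintype.card α - 1 : ℝ) : ℂ) * F w := by
  classical
  obtain _ | ⟨x, u⟩ := w
  · simp at hw
  rw [consSum_apply]
  by_cases h : Reduced (x :: u)
  · have : ∀ s, tailLift F (s :: x :: u) = F (x :: u) - if s = x then F (x :: u) else 0 := by
      intro s
      by_cases hs : s = x
      · simp [tailLift, hs]
      · have h' : Reduced (s :: x :: u) := List.isChain_cons_cons.2 ⟨hs, h⟩
        simp [tailLift, h', hs]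
    simp [this, sub_mul]
  · rw [hF _ h, mul_zero]
    refine Finset.sum_eq_zero fun s _ => ?_
    simp [tailLift, hF _ h]

lemma snocSum_initLift (F : List α → ℂ) (hF : ReducedSupport F) (w : List α) (hw : 1 ≤ w.length) :
    snocSum (initLift F) w = ((Fintype.card α - 1 : ℝ) : ℂ) * F w := by
  have := consSum_tailLift (fun u => F u.reverse) (fun w hw => hF _ (mt reduced_reverse.1 hw))
    w.reverse (by simpa)
  simpa [consSum_apply, snocSum_apply, initLift] using this

lemma snocSum_tailLift (F : List α → ℂ) (hF : ReducedSupport F) (w : List α) (hw : 2 ≤ w.length) :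
    snocSum (tailLift F) w = tailLift (snocSum F) w := by
  classical
  obtain _ | ⟨x, _ | ⟨y, u⟩⟩ := w
  · simp at hw
  · simp at hw
  simp only [snocSum_apply, tailLift, List.cons_append]
  by_cases hxy : x = y
  · simp [Reduced, hxy]
  · have key : ∀ s, (if Reduced (x :: y :: (u ++ [s])) then F (y :: (u ++ [s])) else 0)
        = F (y :: (u ++ [s])) := by
      intro s
      by_cases h : Reduced (y :: (u ++ [s]))
      · rw [if_pos (List.isChain_cons_cons.2 ⟨hxy, h⟩)]
      · rw [hF _ h, ite_self]
    simp only [key]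
    split_ifs with h
    · rfl
    · exact hF.snocSum (y :: u) fun h' => h (List.isChain_cons_cons.2 ⟨hxy, h'⟩)

lemma extSum_tailLift (F : List α → ℂ) (hF : ReducedSupport F) (b : ℕ) (w : List α)
    (hw : 2 ≤ w.length) :
    extSum 0 b (tailLift F) w = tailLift (extSum 0 b F) w := by
  induction b generalizing w with
  | zero => simp [extSum_zero_zero]
  | succ b ih =>
    rw [← snocSum_extSum, ← snocSum_extSum, ← snocSum_tailLift _ (hF.extSum 0 b) w hw]
    exact Finset.sum_congr rfl fun s _ => ih _ (by simp; omega)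

end Words

open Filter Topology

/-- A solution of the discrete wave equation on the quadrant with a linear boundary condition
vanishes if it is `o(lam ^ ((a + b) / 2))`. -/
lemma wave_eq_zero {c : ℕ → ℕ → ℂ} {lam κ : ℝ} (hlam : 0 < lam) (hκ : 0 ≤ κ)
    (hint : ∀ a b, c (a + 2) (b + 1) + lam * c a (b + 1) = c (a + 1) (b + 2) + lam * c (a + 1) b)
    (hbd : ∀ b, c 1 (b + 1) - κ * c 0 b = c 0 (b + 2) + lam * c 0 b)
    {N : ℕ → ℝ} (hN : Tendsto N atTop (𝓝 0))
    (hc : ∀ a b, ‖c a b‖ ^ 2 ≤ lam ^ (a + b) * N (a + b)) (a b : ℕ) : c a b = 0 := by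
  have hdiag : ∀ k a b, c (a + k + 1) (b + k) - c (a + k) (b + k + 1)
      = (lam : ℂ) ^ k * (c (a + 1) b - c a (b + 1)) := by
    intro k a b
    induction k with
    | zero => simp
    | succ k ih =>
      have h := hint (a + k) (b + k)
      rw [pow_succ']
      linear_combination h + (lam : ℂ) * ih
  have hsq : ∀ x y : ℂ, ‖x - y‖ ^ 2 ≤ 2 * ‖x‖ ^ 2 + 2 * ‖y‖ ^ 2 := by
    intro x y
    nlinarith [norm_sub_le x y, norm_nonneg (x - y), norm_nonneg x, norm_nonneg y,
      sq_nonneg (‖x‖ - ‖y‖)]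
  have hE : ∀ a b, c (a + 1) b = c a (b + 1) := by
    intro a b
    rw [← sub_eq_zero, ← norm_eq_zero, ← sq_eq_zero_iff]
    refine le_antisymm ?_ (sq_nonneg _)
    have hbound : ∀ k, ‖c (a + 1) b - c a (b + 1)‖ ^ 2
        ≤ 4 * lam ^ (a + b + 1) * N (a + b + 1 + 2 * k) := by
      intro k
      have h1 := hc (a + k + 1) (b + k)
      have h2 := hc (a + k) (b + k + 1)
      have h3 := hsq (c (a + k + 1) (b + k)) (c (a + k) (b + k + 1))
      rw [hdiag, norm_mul, norm_pow, Complex.norm_of_nonneg hlam.le] at h3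
      rw [show a + k + 1 + (b + k) = a + b + 1 + 2 * k by ring] at h1
      rw [show a + k + (b + k + 1) = a + b + 1 + 2 * k by ring] at h2
      have hpos : 0 < lam ^ (2 * k) := by positivity
      refine le_of_mul_le_mul_left ?_ hpos
      rw [mul_pow, ← pow_mul, mul_comm k 2] at h3
      rw [pow_add lam (a + b + 1)] at h1 h2
      nlinarith
    have hlim : Tendsto (fun k => 4 * lam ^ (a + b + 1) * N (a + b + 1 + 2 * k)) atTop (𝓝 0) := by
      have : Tendsto (fun k => a + b + 1 + 2 * k) atTop atTop :=
        tendsto_atTop_mono (fun k => by simp only [id]; omega) tendsto_id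
      simpa using (hN.comp this).const_mul (4 * lam ^ (a + b + 1))
    exact ge_of_tendsto' hlim hbound
  have h0 : ∀ b, c 0 b = 0 := by
    intro b
    have h := hbd b
    rw [hE 0 (b + 1)] at h
    have hne : ((lam + κ : ℝ) : ℂ) ≠ 0 := by
      exact_mod_cast (by positivity : lam + κ ≠ 0)
    refine (mul_eq_zero.1 ?_).resolve_left hne
    push_cast
    linear_combination -h
  induction a generalizing b with
  | zero => exact h0 b
  | succ a ih => rw [hE, ih]

section Words

variable {α : Type*} [Fintype α]

lemma levelSum_normSq_consSum_le (hα : 1 ≤ Fintype.card α) {G : List α → ℂ}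
    (hG : ReducedSupport G) (l : ℕ) :
    levelSum (l + 1) (fun w => ‖consSum G w‖ ^ 2)
      ≤ (Fintype.card α - 1 : ℝ) * levelSum (l + 2) fun w => ‖G w‖ ^ 2 := by
  classical
  rw [levelSum_cons (l + 1), levelSum, levelSum, Finset.mul_sum]
  refine Finset.sum_le_sum fun v _ => ?_
  rw [consSum_apply, List.ofFn_succ]
  set x := v 0
  set u := List.ofFn fun i => v (Fin.succ i)
  have hx : G (x :: x :: u) = 0 := hG _ (by simp [Reduced])
  have h1 : ∑ s, G (s :: x :: u) = ∑ s ∈ Finset.univ.erase x, G (s :: x :: u) :=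
    (Finset.sum_erase (f := fun s => G (s :: x :: u)) _ hx).symm
  have h2 : ((Finset.univ.erase x).card : ℝ) = Fintype.card α - 1 := by
    rw [Finset.card_erase_of_mem (Finset.mem_univ _), Finset.card_univ, Nat.cast_sub hα,
      Nat.cast_one]
  calc ‖∑ s, G (s :: x :: u)‖ ^ 2
      ≤ (∑ s ∈ Finset.univ.erase x, ‖G (s :: x :: u)‖) ^ 2 := by
        rw [h1]; gcongr; exact norm_sum_le _ _
    _ ≤ (Fintype.card α - 1 : ℝ) * ∑ s ∈ Finset.univ.erase x, ‖G (s :: x :: u)‖ ^ 2 := by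
        rw [← h2]; exact sq_sum_le_card_mul_sum_sq
    _ = (Fintype.card α - 1 : ℝ) * ∑ s, ‖G (s :: x :: u)‖ ^ 2 := by
        rw [Finset.sum_erase _ (by simp [hx])]

lemma levelSum_reverse {M : Type*} [AddCommMonoid M] (l : ℕ) (f : List α → M) :
    levelSum l (fun w => f w.reverse) = levelSum l f := by
  induction l generalizing f with
  | zero => simp [levelSum]
  | succ l ih =>
    rw [levelSum_cons, levelSum_snoc, ← ih]
    simp

lemma levelSum_normSq_snocSum_le (hα : 1 ≤ Fintype.card α) {G : List α → ℂ}
    (hG : ReducedSupport G) (l : ℕ) :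
    levelSum (l + 1) (fun w => ‖snocSum G w‖ ^ 2)
      ≤ (Fintype.card α - 1 : ℝ) * levelSum (l + 2) fun w => ‖G w‖ ^ 2 := by
  have h := levelSum_normSq_consSum_le hα (G := fun w => G w.reverse)
    (fun w hw => hG _ (mt reduced_reverse.1 hw)) l
  rw [levelSum_reverse (l + 2) fun w => ‖G w‖ ^ 2, ← levelSum_reverse (l + 1)] at h
  simpa [consSum_apply, snocSum_apply] using h

lemma levelSum_normSq_extSum_le (hα : 1 ≤ Fintype.card α) {F : List α → ℂ}
    (hF : ReducedSupport F) (l a b : ℕ) :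
    levelSum (l + 1) (fun w => ‖extSum a b F w‖ ^ 2)
      ≤ (Fintype.card α - 1 : ℝ) ^ (a + b) * levelSum (l + 1 + (a + b)) fun w => ‖F w‖ ^ 2 := by
  have hlam : (0 : ℝ) ≤ Fintype.card α - 1 := sub_nonneg.2 (by exact_mod_cast hα)
  induction a generalizing l with
  | zero =>
    induction b generalizing l with
    | zero => simp [extSum_zero_zero]
    | succ b ih =>
      rw [← snocSum_extSum]
      refine (levelSum_normSq_snocSum_le hα (hF.extSum 0 b) l).trans ?_
      refine (mul_le_mul_of_nonneg_left (ih (l + 1)) hlam).trans_eq ?_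
      rw [← mul_assoc, show l + 1 + 1 + (0 + b) = l + 1 + (0 + (b + 1)) by ring]
      ring
  | succ a ih =>
    rw [← consSum_extSum]
    refine (levelSum_normSq_consSum_le hα (hF.extSum a b) l).trans ?_
    refine (mul_le_mul_of_nonneg_left (ih (l + 1)) hlam).trans_eq ?_
    rw [← mul_assoc, show l + 1 + 1 + (a + b) = l + 1 + (a + 1 + b) by ring]
    ring

lemma norm_levelSum_mul_sq_le (l : ℕ) (β G : List α → ℂ) :
    ‖levelSum l fun w => β w * G w‖ ^ 2
      ≤ (levelSum l fun w => ‖β w‖ ^ 2) * levelSum l fun w => ‖G w‖ ^ 2 := by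
  unfold levelSum
  refine le_trans ?_ (Finset.sum_mul_sq_le_sq_mul_sq _ _ _)
  gcongr
  exact (norm_sum_le _ _).trans_eq (by simp)

/-- The boundary term in the recursion for the coefficients along a test function `β` all of
whose one-letter extension sums vanish. -/
lemma exists_levelSum_tailLift {F β : List α → ℂ} (hF : ReducedSupport F)
    (hβ : ReducedSupport β) {l : ℕ} (hβl : ∀ w, w.length = l → consSum β w = 0) :
    ∃ κ : ℝ, 0 ≤ κ ∧ ∀ b, levelSum (l + 1) (fun w => β w * extSum 0 (b + 1) (tailLift F) w)
      = -(κ * levelSum (l + 1) fun w => β w * extSum 0 b F w) := by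
  classical
  obtain _ | l := l
  · refine ⟨1, zero_le_one, fun b => ?_⟩
    have key : ∀ s : α, extSum 0 (b + 1) (tailLift F) [s]
        = (∑ t, extSum 0 b F [t]) - extSum 0 b F [s] := by
      intro s
      rw [← snocSum_extSum, snocSum_apply]
      have : ∀ t, extSum 0 b (tailLift F) ([s] ++ [t])
          = extSum 0 b F [t] - if s = t then extSum 0 b F [t] else 0 := by
        intro t
        rw [extSum_tailLift F hF b _ (by simp)]
        by_cases hst : s = t <;> simp [tailLift, Reduced, hst]
      simp only [List.singleton_append] at this
      simp [this]
    have h0 : ∑ s : α, β [s] = 0 := hβl [] rfl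
    rw [levelSum_cons, levelSum_cons]
    simp [levelSum, key, mul_sub, ← Finset.sum_mul, h0]
  · refine ⟨0, le_rfl, fun b => ?_⟩
    rw [levelSum_congr (g := fun w => β w * tailLift (extSum 0 (b + 1) F) w)
      fun w hw => by rw [extSum_tailLift F hF _ w (by omega)], levelSum_cons]
    rw [levelSum_congr (g := fun _ => 0)]
    · simp [levelSum]
    · intro w hw
      have : ∀ s, β (s :: w) * tailLift (extSum 0 (b + 1) F) (s :: w)
          = β (s :: w) * extSum 0 (b + 1) F w := by
        intro s
        by_cases h : Reduced (s :: w)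
        · simp [tailLift, h]
        · simp [hβ _ h]
      simp only [this, ← Finset.sum_mul]
      rw [← consSum_apply, hβl w hw, zero_mul]

/-- A square-summable solution of the commutation equation is orthogonal, after any number of
extension sums, to every test function all of whose one-letter extension sums vanish. -/
lemma levelSum_mul_extSum_eq_zero (hα : 2 ≤ Fintype.card α) {F β : List α → ℂ}
    (hF : ReducedSupport F) (heq : consSum F + tailLift F = snocSum F + initLift F)
    (hlim : Tendsto (fun l => levelSum l fun w => ‖F w‖ ^ 2) atTop (𝓝 0))
    (hβ : ReducedSupport β) {l : ℕ} (hβl : ∀ w, w.length = l → consSum β w = 0) (a b : ℕ) :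
    levelSum (l + 1) (fun w => β w * extSum a b F w) = 0 := by
  set lam : ℝ := Fintype.card α - 1
  have hlam : 0 < lam := sub_pos.2 (by exact_mod_cast hα)
  obtain ⟨κ, hκ, hK⟩ := exists_levelSum_tailLift hF hβ hβl
  have htail : ∀ a b w, 1 ≤ w.length →
      extSum (a + 1) b (tailLift F) w = lam * extSum a b F w := by
    intro a b w hw
    rw [← extSum_consSum, extSum_congr (G := (lam : ℂ) • F)
      (fun w hw => consSum_tailLift F hF w hw) a b w hw, extSum_smul]
    simp
  have hinit : ∀ a b w, 1 ≤ w.length →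
      extSum a (b + 1) (initLift F) w = lam * extSum a b F w := by
    intro a b w hw
    rw [← extSum_snocSum, extSum_congr (G := (lam : ℂ) • F)
      (fun w hw => snocSum_initLift F hF w hw) a b w hw, extSum_smul]
    simp
  have hwave : ∀ a b w, extSum (a + 1) b F w + extSum a b (tailLift F) w
      = extSum a (b + 1) F w + extSum a b (initLift F) w := by
    intro a b w
    have := congrFun (congrArg (extSum a b) heq) w
    simpa only [extSum_add, extSum_consSum, extSum_snocSum, Pi.add_apply] using this
  have hpair : ∀ {f₁ f₂ f₃ f₄ : List α → ℂ},
      (∀ w : List α, w.length = l + 1 → f₁ w + f₂ w = f₃ w + f₄ w) →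
      levelSum (l + 1) (fun w => β w * f₁ w) + levelSum (l + 1) (fun w => β w * f₂ w)
        = levelSum (l + 1) (fun w => β w * f₃ w) + levelSum (l + 1) (fun w => β w * f₄ w) := by
    intro f₁ f₂ f₃ f₄ h
    simp only [levelSum, ← Finset.sum_add_distrib, ← mul_add]
    exact Finset.sum_congr rfl fun v _ => by rw [h _ (by simp)]
  have hsmul : ∀ f : List α → ℂ, levelSum (l + 1) (fun w => β w * (lam * f w))
      = lam * levelSum (l + 1) fun w => β w * f w := by
    intro f
    simp only [levelSum, Finset.mul_sum]
    exact Finset.sum_congr rfl fun v _ => by ring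
  refine wave_eq_zero (c := fun a b => levelSum (l + 1) fun w => β w * extSum a b F w)
    (N := fun k => (levelSum (l + 1) fun w => ‖β w‖ ^ 2) *
      levelSum (l + 1 + k) fun w => ‖F w‖ ^ 2) hlam hκ ?_ ?_ ?_ ?_ a b
  · intro a b
    simp only [← hsmul]
    refine hpair fun w hw => ?_
    rw [← htail a (b + 1) w (by omega), ← hinit (a + 1) b w (by omega)]
    exact hwave (a + 1) (b + 1) w
  · intro b
    simp only [sub_eq_add_neg, ← hK, ← hsmul]
    refine hpair fun w hw => ?_
    rw [← hinit 0 b w (by omega)]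
    exact hwave 0 (b + 1) w
  · have : Tendsto (fun k => l + 1 + k) atTop atTop :=
      tendsto_atTop_mono (fun k => by simp only [id]; omega) tendsto_id
    simpa using (hlim.comp this).const_mul (levelSum (l + 1) fun w => ‖β w‖ ^ 2)
  · intro a b
    refine (norm_levelSum_mul_sq_le _ _ _).trans ?_
    have h0 : 0 ≤ levelSum (l + 1) fun w => ‖β w‖ ^ 2 := Finset.sum_nonneg fun _ _ => sq_nonneg _
    refine (mul_le_mul_of_nonneg_left
      (levelSum_normSq_extSum_le (by omega) hF l a b) h0).trans_eq ?_
    ring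

/-- The number of reduced one-letter extensions of a reduced word of length `l`. -/
lemma exists_extension_count (hα : 2 ≤ Fintype.card α) (l : ℕ) :
    ∃ m : ℂ, m ≠ 0 ∧ ∀ w : List α, w.length = l →
      consSum reducedIndicator w = m * reducedIndicator w := by
  classical
  obtain _ | l := l
  · refine ⟨Fintype.card α, by exact_mod_cast (by omega), fun w hw => ?_⟩
    obtain rfl := List.length_eq_zero_iff.1 hw
    simp [consSum_apply, reducedIndicator]
  · refine ⟨Fintype.card α - 1, ?_, fun w hw => ?_⟩
    · rw [sub_ne_zero]
      exact_mod_cast (by omega)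
    obtain _ | ⟨x, u⟩ := w
    · simp at hw
    have : ∀ s, reducedIndicator (s :: x :: u)
        = reducedIndicator (x :: u) - if s = x then reducedIndicator (x :: u) else 0 := by
      intro s
      by_cases hs : s = x <;> simp [reducedIndicator, Reduced, hs]
    simp [consSum_apply, this, sub_mul]

/-- Square-summable solutions of the commutation equation are radial. -/
lemma exists_extSum_eq_mul_indicator (hα : 2 ≤ Fintype.card α) {F : List α → ℂ}
    (hF : ReducedSupport F) (heq : consSum F + tailLift F = snocSum F + initLift F)
    (hlim : Tendsto (fun l => levelSum l fun w => ‖F w‖ ^ 2) atTop (𝓝 0)) (l a b : ℕ) :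
    ∃ r : ℂ, ∀ w, w.length = l → extSum a b F w = r * reducedIndicator w := by
  induction l generalizing a b with
  | zero =>
    refine ⟨extSum a b F [], fun w hw => ?_⟩
    obtain rfl := List.length_eq_zero_iff.1 hw
    simp [reducedIndicator]
  | succ l ih =>
    obtain ⟨r₁, h₁⟩ := ih (a + 1) b
    obtain ⟨m, hm, hcount⟩ := exists_extension_count hα l
    set g := extSum a b F
    refine ⟨r₁ / m, fun w hw => ?_⟩
    set β : List α → ℂ := g - (r₁ / m) • reducedIndicator
    have hβs : ReducedSupport β := fun w hw => by
      simp [β, hF.extSum a b w hw, reducedIndicator, hw, g]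
    have hβ : ∀ w, w.length = l → consSum β w = 0 := by
      intro w hw
      simp only [β, map_sub, map_smul, Pi.sub_apply, Pi.smul_apply, smul_eq_mul, hcount w hw,
        g, consSum_extSum, h₁ w hw]
      field_simp
      ring
    have hcs : ReducedSupport (fun w => star (β w)) := fun w hw => by simp [hβs w hw]
    have hc : ∀ w, w.length = l → consSum (fun w => star (β w)) w = 0 := by
      intro w hw
      rw [consSum_apply, ← star_sum, ← consSum_apply, hβ w hw, star_zero]
    have h0 : levelSum (l + 1) (fun w => star (β w) * g w) = 0 :=
      levelSum_mul_extSum_eq_zero hα hF heq hlim hcs hc a b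
    have h1 : levelSum (l + 1) (fun w => star (β w)) = 0 := by
      rw [← levelSum_consSum, levelSum_congr (g := fun _ => 0) hc]
      simp [levelSum]
    have h2 : levelSum (l + 1) (fun w => ‖β w‖ ^ 2) = 0 := by
      have : ((levelSum (l + 1) (fun w => ‖β w‖ ^ 2) : ℝ) : ℂ)
          = levelSum (l + 1) (fun w => star (β w) * g w)
            - (r₁ / m) * levelSum (l + 1) (fun w => star (β w)) := by
        simp only [levelSum, Finset.mul_sum, ← Finset.sum_sub_distrib, Complex.ofReal_sum]
        refine Finset.sum_congr rfl fun v _ => ?_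
        set w := List.ofFn v
        have hb : star (β w) * reducedIndicator w = star (β w) := by
          by_cases hw : Reduced w
          · simp [reducedIndicator, hw]
          · simp [hβs w hw]
        have hn : ((‖β w‖ ^ 2 : ℝ) : ℂ) = star (β w) * β w := by
          simpa using (Complex.conj_mul' (β w)).symm
        have hβw : β w = g w - (r₁ / m) * reducedIndicator w := rfl
        rw [hn]
        nth_rewrite 2 [hβw]
        linear_combination -(r₁ / m) * hb
      rw [h0, h1] at this
      simpa using this
    obtain ⟨v, rfl⟩ := exists_ofFn_eq hw
    have h3 := (Finset.sum_eq_zero_iff_of_nonneg fun _ _ => sq_nonneg _).1 h2 v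
      (Finset.mem_univ _)
    have h4 : β (List.ofFn v) = 0 := by simpa using h3
    exact sub_eq_zero.1 h4

end Words

section NormalForm

variable {L : ℕ}

/-- Left multiplication of a reduced word by a letter. -/
def consReduce (s : Fin L) : {w : List (Fin L) // Reduced w} → {w : List (Fin L) // Reduced w}
  | ⟨[], _⟩ => ⟨[s], by simp [Reduced]⟩
  | ⟨x :: u, h⟩ =>
    if hs : s = x then ⟨u, h.tail⟩ else ⟨s :: x :: u, List.isChain_cons_cons.2 ⟨hs, h⟩⟩

lemma consReduce_of_reduced {s : Fin L} {w : List (Fin L)} (h : Reduced (s :: w)) :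
    consReduce s ⟨w, h.tail⟩ = ⟨s :: w, h⟩ := by
  obtain _ | ⟨x, u⟩ := w
  · rfl
  · have hs : s ≠ x := (List.isChain_cons_cons.1 h).1
    simp [consReduce, hs]

lemma consReduce_cons_self {s : Fin L} {w : List (Fin L)} (h : Reduced (s :: w)) :
    consReduce s ⟨s :: w, h⟩ = ⟨w, h.tail⟩ := by
  simp [consReduce]

lemma reduced_cons_or_exists {s : Fin L} {w : List (Fin L)} (h : Reduced w) :
    Reduced (s :: w) ∨ ∃ u, w = s :: u := by
  obtain _ | ⟨x, u⟩ := w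
  · simp [Reduced]
  · by_cases hs : s = x
    · exact Or.inr ⟨u, by rw [hs]⟩
    · exact Or.inl (List.isChain_cons_cons.2 ⟨hs, h⟩)

lemma consReduce_consReduce (s : Fin L) (w : {w : List (Fin L) // Reduced w}) :
    consReduce s (consReduce s w) = w := by
  obtain ⟨w, h⟩ := w
  obtain hs | ⟨u, rfl⟩ := reduced_cons_or_exists (s := s) h
  · rw [consReduce_of_reduced hs, consReduce_cons_self]
  · rw [consReduce_cons_self, consReduce_of_reduced h]

lemma wordProd_consReduce (s : Fin L) (w : {w : List (Fin L) // Reduced w}) :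
    (cs L).wordProd (consReduce s w).1 = σ s * (cs L).wordProd w.1 := by
  obtain ⟨w, h⟩ := w
  obtain hs | ⟨u, rfl⟩ := reduced_cons_or_exists (s := s) h
  · rw [consReduce_of_reduced hs, CoxeterSystem.wordProd_cons, σ]
  · rw [consReduce_cons_self, CoxeterSystem.wordProd_cons, σ,
      CoxeterSystem.simple_mul_simple_cancel_left]

lemma length_consReduce_le (s : Fin L) (w : {w : List (Fin L) // Reduced w}) :
    (consReduce s w).1.length ≤ w.1.length + 1 := by
  obtain ⟨w, h⟩ := w
  obtain hs | ⟨u, rfl⟩ := reduced_cons_or_exists (s := s) h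
  · rw [consReduce_of_reduced hs]
    simp
  · rw [consReduce_cons_self]
    simp
    omega

lemma isLiftable_consReduce :
    (Mat L).IsLiftable (G := Function.End {w : List (Fin L) // Reduced w}) consReduce := by
  intro i j
  by_cases hij : i = j
  · subst hij
    have : (Mat L).M i i = 1 := (Mat L).diagonal i
    rw [this, pow_one]
    exact funext fun w => consReduce_consReduce i w
  · have : (Mat L).M i j = 0 := by simp [Mat, hij]
    rw [this, pow_zero]

/-- The action of the group on reduced words. -/
def wordAction (L : ℕ) : W L →* Function.End {w : List (Fin L) // Reduced w} :=
  (cs L).lift ⟨consReduce, isLiftable_consReduce⟩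

lemma wordAction_simple (s : Fin L) : wordAction L (σ s) = consReduce s :=
  (cs L).lift_apply_simple isLiftable_consReduce s

/-- The reduced word of a group element. -/
def normalForm (w : W L) : {w : List (Fin L) // Reduced w} :=
  wordAction L w ⟨[], List.isChain_nil⟩

lemma normalForm_one : normalForm (1 : W L) = ⟨[], List.isChain_nil⟩ := by
  rw [normalForm, map_one]
  rfl

lemma normalForm_simple_mul (s : Fin L) (w : W L) :
    normalForm (σ s * w) = consReduce s (normalForm w) := by
  rw [normalForm, map_mul, wordAction_simple]
  rfl

lemma normalForm_wordProd {w : List (Fin L)} (h : Reduced w) :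
    normalForm ((cs L).wordProd w) = ⟨w, h⟩ := by
  induction w with
  | nil => rw [CoxeterSystem.wordProd_nil, normalForm_one]
  | cons s u ih =>
    rw [CoxeterSystem.wordProd_cons, ← σ, normalForm_simple_mul, ih h.tail, consReduce_of_reduced h]

lemma wordProd_normalForm (w : W L) : (cs L).wordProd (normalForm w).1 = w := by
  induction w using (cs L).simple_induction_left with
  | one => rw [normalForm_one, CoxeterSystem.wordProd_nil]
  | mul_simple_left w s ih => rw [← σ, normalForm_simple_mul, wordProd_consReduce, ih]

lemma wordProd_injOn {u w : List (Fin L)} (hu : Reduced u) (hw : Reduced w)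
    (h : (cs L).wordProd u = (cs L).wordProd w) : u = w := by
  have := normalForm_wordProd hu
  rw [h, normalForm_wordProd hw] at this
  exact (Subtype.ext_iff.1 this).symm

lemma len_eq_length_normalForm (w : W L) : len w = (normalForm w).1.length := by
  refine le_antisymm ?_ ?_
  · conv_lhs => rw [← wordProd_normalForm w]
    exact (cs L).length_wordProd_le _
  · obtain ⟨u, hu, rfl⟩ := (cs L).exists_isReduced w
    rw [len, hu]
    clear hu
    induction u with
    | nil => simp [normalForm_one]
    | cons s u ih =>
      rw [CoxeterSystem.wordProd_cons, ← σ, normalForm_simple_mul, List.length_cons]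
      exact (length_consReduce_le _ _).trans (by omega)

lemma len_wordProd {w : List (Fin L)} (h : Reduced w) : len ((cs L).wordProd w) = w.length := by
  rw [len_eq_length_normalForm, normalForm_wordProd h]

lemma len_simple_mul_lt_iff (s : Fin L) {w : List (Fin L)} (h : Reduced w) :
    len (σ s * (cs L).wordProd w) < len ((cs L).wordProd w) ↔ w.head? = some s := by
  rw [len_eq_length_normalForm, normalForm_simple_mul, normalForm_wordProd h, len_wordProd h]
  obtain hs | ⟨u, rfl⟩ := reduced_cons_or_exists (s := s) h
  · rw [consReduce_of_reduced hs]
    obtain _ | ⟨x, u⟩ := w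
    · simp
    · have hx : x ≠ s := (List.isChain_cons_cons.1 hs).1.symm
      simp [hx]
  · rw [consReduce_cons_self]
    simp

open Classical in
/-- The left descent terms of `h δ_w` add up to `p δ_w`, except for `w = e`. -/
lemma sum_left_descent (p : ℂ) (w : W L) :
    ∑ s : Fin L, (if len (σ s * w) < len w then p else 0) = if w = 1 then 0 else p := by
  have h := (normalForm w).2
  have hw := wordProd_normalForm w
  generalize (normalForm w).1 = u at h hw
  subst hw
  simp only [len_simple_mul_lt_iff _ h]
  obtain _ | ⟨x, u⟩ := u
  · simp
  · have : (cs L).wordProd (x :: u) ≠ 1 := fun h1 => by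
      have := wordProd_injOn h List.isChain_nil (h1.trans (cs L).wordProd_nil.symm)
      simp at this
    simp [this]

open Classical in
lemma sum_right_descent (p : ℂ) (w : W L) :
    ∑ s : Fin L, (if len (w * σ s) < len w then p else 0) = if w = 1 then 0 else p := by
  have hinv : ∀ v : W L, len v⁻¹ = len v := (cs L).length_inv
  have hσ : ∀ s : Fin L, (σ s)⁻¹ = σ s := (cs L).inv_simple
  have h := sum_left_descent p w⁻¹
  rw [inv_eq_one] at h
  rw [← h]
  refine Finset.sum_congr rfl fun s _ => ?_
  rw [hinv w, ← hinv (w * σ s), mul_inv_rev, hσ]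

open Classical in
/-- A function on the group, regarded as a function on reduced words. -/
def onWords (ξ : W L → ℂ) (w : List (Fin L)) : ℂ :=
  if Reduced w then ξ ((cs L).wordProd w) else 0

lemma reducedSupport_onWords (ξ : W L → ℂ) : ReducedSupport (onWords ξ) := fun _ hw => if_neg hw

lemma sum_simple_mul (ξ : W L → ℂ) {w : List (Fin L)} (h : Reduced w) :
    ∑ s, ξ (σ s * (cs L).wordProd w) = consSum (onWords ξ) w + tailLift (onWords ξ) w := by
  have key : ∀ s, ξ (σ s * (cs L).wordProd w)
      = onWords ξ (s :: w) + if w.head? = some s then tailLift (onWords ξ) w else 0 := by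
    intro s
    obtain hs | ⟨u, rfl⟩ := reduced_cons_or_exists (s := s) h
    · have : w.head? ≠ some s := by
        obtain _ | ⟨x, u⟩ := w
        · simp
        · simpa using (List.isChain_cons_cons.1 hs).1.symm
      simp [onWords, hs, this, CoxeterSystem.wordProd_cons, σ]
    · have : ¬ Reduced (s :: s :: u) := by simp [Reduced]
      rw [CoxeterSystem.wordProd_cons, σ, CoxeterSystem.simple_mul_simple_cancel_left]
      have hu : Reduced u := h.tail
      rw [onWords, if_neg this]
      simp [tailLift, onWords, hu, h]
  simp only [key, Finset.sum_add_distrib, consSum_apply]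
  congr 1
  obtain _ | ⟨x, u⟩ := w
  · simp [tailLift]
  · simp

lemma onWords_inv (ξ : W L → ℂ) (w : List (Fin L)) :
    onWords (fun g => ξ g⁻¹) w = onWords ξ w.reverse := by
  simp only [onWords, reduced_reverse, CoxeterSystem.wordProd_reverse]

lemma sum_mul_simple (ξ : W L → ℂ) {w : List (Fin L)} (h : Reduced w) :
    ∑ s, ξ ((cs L).wordProd w * σ s) = snocSum (onWords ξ) w + initLift (onWords ξ) w := by
  have hσ : ∀ s : Fin L, (σ s)⁻¹ = σ s := (cs L).inv_simple
  have := sum_simple_mul (fun g => ξ g⁻¹) (reduced_reverse.2 h)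
  have he : onWords (fun g => ξ g⁻¹) = fun w => onWords ξ w.reverse := funext (onWords_inv ξ)
  rw [he] at this
  simpa [consSum_apply, snocSum_apply, initLift, hσ] using this

lemma consSum_add_tailLift_onWords {ξ : W L → ℂ}
    (h : ∀ g, ∑ s, ξ (σ s * g) = ∑ s, ξ (g * σ s)) :
    consSum (onWords ξ) + tailLift (onWords ξ) = snocSum (onWords ξ) + initLift (onWords ξ) := by
  have htail : ∀ (F : List (Fin L) → ℂ) w, ¬ Reduced w → tailLift F w = 0 := by
    rintro F (_ | ⟨x, u⟩) hw
    · rfl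
    · exact if_neg hw
  ext w
  by_cases hw : Reduced w
  · rw [Pi.add_apply, Pi.add_apply, ← sum_simple_mul ξ hw, ← sum_mul_simple ξ hw, h]
  · have hs := reducedSupport_onWords ξ
    rw [Pi.add_apply, Pi.add_apply, hs.consSum w hw, hs.snocSum w hw, htail _ w hw, initLift,
      htail _ _ (mt reduced_reverse.1 hw)]

lemma tendsto_levelSum_onWords {ξ : W L → ℂ} (hξ : Summable fun g => ‖ξ g‖ ^ 2) :
    Tendsto (fun l => levelSum l fun w => ‖onWords ξ w‖ ^ 2) atTop (𝓝 0) := by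
  have h1 : Summable fun w : {w : List (Fin L) // Reduced w} => ‖ξ ((cs L).wordProd w.1)‖ ^ 2 :=
    hξ.comp_injective (i := fun w : {w : List (Fin L) // Reduced w} => (cs L).wordProd w.1)
      fun u w h => Subtype.ext (wordProd_injOn u.2 w.2 h)
  have h2 : Summable fun w : List (Fin L) => ‖onWords ξ w‖ ^ 2 := by
    refine (Function.Injective.summable_iff (g := fun w : {w : List (Fin L) // Reduced w} => w.1)
      Subtype.val_injective ?_).1 ?_
    · intro w hw
      have : ¬ Reduced w := fun h => hw ⟨⟨w, h⟩, rfl⟩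
      simp [onWords, this]
    · convert h1 using 2 with w
      simp [onWords, w.2]
  have h3 := (List.equivSigmaTuple (α := Fin L)).symm.summable_iff.2 h2
  have h4 := h3.sigma.tendsto_atTop_zero
  simpa [levelSum, tsum_fintype, List.equivSigmaTuple] using h4

/-- A square-summable function on the group commuting with the generating sum is radial. -/
theorem eq_of_len_eq (hL : 2 ≤ L) {ξ : W L → ℂ} (hξ : Summable fun g => ‖ξ g‖ ^ 2)
    (h : ∀ g, ∑ s, ξ (σ s * g) = ∑ s, ξ (g * σ s)) {v w : W L} (hvw : len v = len w) :
    ξ v = ξ w := by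
  obtain ⟨r, hr⟩ := exists_extSum_eq_mul_indicator (α := Fin L) (by simpa using hL)
    (reducedSupport_onWords ξ) (consSum_add_tailLift_onWords h) (tendsto_levelSum_onWords hξ)
    (len w) 0 0
  have key : ∀ g, len g = len w → ξ g = r := by
    intro g hg
    have := hr (normalForm g).1 (by rw [← len_eq_length_normalForm, hg])
    simpa [extSum_zero_zero, onWords, reducedIndicator, (normalForm g).2,
      wordProd_normalForm] using this
  rw [key v hvw, key w rfl]

lemma inner_δ (w : W L) (ξ : H L) : inner ℂ (δ w) ξ = ξ w := by
  classical
  have := lp.inner_single_left (𝕜 := ℂ) (G := fun _ : W L => ℂ) w (1 : ℂ) ξ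
  rw [δ]
  convert this using 2
  simp

open Classical in
lemma sum_left_apply_δ {p : ℂ} {T : Fin L → H L →L[ℂ] H L} {w : W L}
    (hT : ∀ s, T s (δ w) =
      if len (σ s * w) < len w then δ (σ s * w) + p • δ w else δ (σ s * w)) :
    (∑ s, T s) (δ w) = ∑ s, δ (σ s * w) + (if w = 1 then 0 else p) • δ w := by
  rw [sum_apply, ← sum_left_descent p w, Finset.sum_smul, ← Finset.sum_add_distrib]
  refine Finset.sum_congr rfl fun s _ => ?_
  rw [hT]
  split_ifs <;> simp

open Classical in
lemma sum_right_apply_δ {p : ℂ} {T : Fin L → H L →L[ℂ] H L} {w : W L}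
    (hT : ∀ s, T s (δ w) =
      if len (w * σ s) < len w then δ (w * σ s) + p • δ w else δ (w * σ s)) :
    (∑ s, T s) (δ w) = ∑ s, δ (w * σ s) + (if w = 1 then 0 else p) • δ w := by
  rw [sum_apply, ← sum_right_descent p w, Finset.sum_smul, ← Finset.sum_add_distrib]
  refine Finset.sum_congr rfl fun s _ => ?_
  rw [hT]
  split_ifs <;> simp

end NormalForm

theorem statement2
    (L : ℕ) (hL : 3 ≤ L) (q p : ℝ) (hq : 0 < q) (hq1 : q ≤ 1)
    (hp : p = (q - 1) / Real.sqrt q)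
    (T : Fin L → H L →L[ℂ] H L)
    (hT : ∀ (s : Fin L) (w : W L),
      T s (δ w) =
        if len (σ s * w) < len w then δ (σ s * w) + (p : ℂ) • δ w else δ (σ s * w))
    (h : H L →L[ℂ] H L) (hh : h = ∑ s, T s)
    (Tr : Fin L → H L →L[ℂ] H L)
    (hTr : ∀ (s : Fin L) (w : W L),
      Tr s (δ w) =
        if len (w * σ s) < len w then δ (w * σ s) + (p : ℂ) • δ w else δ (w * σ s))
    (Rh : H L →L[ℂ] H L) (hRh : Rh = ∑ s, Tr s)
    (v w : W L) (hvw : len v = len w) (ε : ℝ) (hε : 0 < ε) :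
    ∃ η : H L, ‖δ v - δ w - (h η - Rh η)‖ < ε := by
  have hmem : δ v - δ w ∈ (LinearMap.range (h - Rh).toLinearMap).topologicalClosure := by
    rw [← Submodule.orthogonal_orthogonal_eq_closure, Submodule.mem_orthogonal']
    intro ξ hξ
    rw [Submodule.mem_orthogonal] at hξ
    have hsum : Summable fun g => ‖ξ g‖ ^ 2 := by
      simpa using (lp.memℓp ξ).summable (by simp)
    have hcomm : ∀ g, ∑ s, ξ (σ s * g) = ∑ s, ξ (g * σ s) := by
      intro g
      have h0 := hξ _ ⟨δ g, rfl⟩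
      rw [ContinuousLinearMap.coe_coe, sub_apply, hh, hRh,
        sum_left_apply_δ fun s => hT s g, sum_right_apply_δ fun s => hTr s g,
        add_sub_add_right_eq_sub, inner_sub_left, sum_inner, sum_inner] at h0
      simpa [inner_δ, sub_eq_zero] using h0
    rw [inner_sub_left, inner_δ, inner_δ, eq_of_len_eq (by omega) hsum hcomm hvw, sub_self]
  obtain ⟨_, ⟨η, rfl⟩, hη⟩ := Metric.mem_closure_iff.1 hmem ε hε
  exact ⟨η, by simpa [dist_eq_norm] using hη⟩

end UCoxMasa
end
end
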